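/- Upper bound for total torsion of small solutions: if 𝒯 ∈ C²(B,ℝ^N) ∩ C⁰(B̄) solves Δ𝒯 = -δ𝒯 + 𝒮 in B, 𝒯 = 0 on ∂B, with |δ𝒯| ≤ (√(n-2)/2)|∇𝒯|², and ‖𝒯‖_{L^∞(B)} ≤ 2/√(n-2) with strict inequality 2 - √(n-2)‖𝒯‖_{L^∞(B)} > 0, then 2‖∇𝒯‖²_{L²(B)} ≤ 4‖𝒯‖_{L^∞(B)}‖𝒮‖_{L¹(B)} / (2 - √(n-2)‖𝒯‖_{L^∞(B)}). -/

import Mathlib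

open MeasureTheory

lemma aux_div_zero {B K : Set (ℝ × ℝ)} (hBo : IsOpen B) (hK : IsCompact K) (hKB : K ⊆ B)
    {X : ℝ × ℝ → ℝ} (hX : ContDiffOn ℝ 1 X B) (h0 : ∀ p ∈ B, p ∉ K → X p = 0) (e : ℝ × ℝ) :
    IntegrableOn (fun w => fderiv ℝ X w e) B ∧ ∫ w in B, fderiv ℝ X w e = 0 := by
  set Y : ℝ × ℝ → ℝ := B.indicator X with hY
  have hY0 : ∀ p, p ∉ K → Y p = 0 := by
    intro p hp
    by_cases hpB : p ∈ B
    · simp [hY, hpB, h0 p hpB hp]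
    · simp [hY, hpB]
  have hYX : ∀ p ∈ B, Y =ᶠ[nhds p] X := by
    intro p hp
    filter_upwards [hBo.mem_nhds hp] with q hq
    simp [hY, hq]
  have hYz : ∀ p, p ∉ K → Y =ᶠ[nhds p] fun _ => 0 := by
    intro p hp
    filter_upwards [hK.isClosed.isOpen_compl.mem_nhds hp] with q hq
    exact hY0 q hq
  have hYc : ContDiff ℝ 1 Y := by
    rw [contDiff_iff_contDiffAt]
    intro p
    by_cases hp : p ∈ B
    · exact (hX.contDiffAt (hBo.mem_nhds hp)).congr_of_eventuallyEq (hYX p hp)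
    · exact contDiffAt_const.congr_of_eventuallyEq (hYz p (fun h => hp (hKB h)))
  have hYs : HasCompactSupport Y := HasCompactSupport.intro hK hY0
  have hYi : Integrable Y := hYc.continuous.integrable_of_hasCompactSupport hYs
  have hDs : HasCompactSupport (fun w => fderiv ℝ Y w e) := hYs.fderiv_apply ℝ e
  have hDc : Continuous (fun w => fderiv ℝ Y w e) :=
    (hYc.continuous_fderiv one_ne_zero).clm_apply continuous_const
  have hDi : Integrable (fun w => fderiv ℝ Y w e) := hDc.integrable_of_hasCompactSupport hDs
  have hz : ∫ w, fderiv ℝ Y w e = 0 := by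
    have := integral_mul_fderiv_eq_neg_fderiv_mul_of_integrable (𝕜 := ℝ)
      (μ := (volume : Measure (ℝ × ℝ))) (f := fun _ => (1 : ℝ)) (g := Y) (v := e)
      (by simp) (by simpa using hDi) (by simpa using hYi)
      (fun x _ => differentiableAt_const _)
      (fun x _ => hYc.differentiable one_ne_zero x)
    simpa using this
  have heq : ∀ w ∈ B, fderiv ℝ X w e = fderiv ℝ Y w e := fun w hw => by
    rw [(hYX w hw).fderiv_eq]
  refine ⟨(hDi.integrableOn).congr_fun (fun w hw => (heq w hw).symm) hBo.measurableSet, ?_⟩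
  rw [setIntegral_congr_fun hBo.measurableSet heq, setIntegral_eq_integral_of_forall_compl_eq_zero, hz]
  intro w hw
  rw [(hYz w (fun h => hw (hKB h))).fderiv_eq]
  simp

lemma aux_bound {B : Set (ℝ × ℝ)} (hBo : IsOpen B) (hBc : IsCompact (closure B))
    {v f g : ℝ × ℝ → ℝ} (hv : ContDiffOn ℝ 2 v B) (hvc : ContinuousOn v (closure B))
    (hv0 : ∀ p ∈ closure B, p ∉ B → v p = 0) (hvpos : ∀ p ∈ B, 0 < v p)
    (hf : ContinuousOn f B) (hf0 : ∀ p ∈ B, 0 ≤ f p) (hg : IntegrableOn g B)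
    (hg0 : ∀ p ∈ B, 0 ≤ g p)
    (hfg : ∀ w ∈ B, f w ≤ fderiv ℝ (fun p => fderiv ℝ v p (1, 0)) w (1, 0)
        + fderiv ℝ (fun p => fderiv ℝ v p (0, 1)) w (0, 1) + g w) :
    ∫ w in B, f w ≤ ∫ w in B, g w := by
  have hBm := hBo.measurableSet
  let φ : ℕ → ℝ → ℝ := fun k t => Real.smoothTransition (k * t - 1)
  have hφc : ∀ k, ContDiff ℝ 1 (φ k) := fun k =>
    (Real.smoothTransition.contDiff (n := 1)).comp (by fun_prop)
  have hφm : ∀ k, Monotone (φ k) := fun k s t hst =>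
    Real.smoothTransition.monotone (by gcongr)
  have hdv : ContDiffOn ℝ 1 (fderiv ℝ v) B := hv.fderiv_of_isOpen hBo (by norm_num)
  have hdve : ∀ e, ContDiffOn ℝ 1 (fun p => fderiv ℝ v p e) B := fun e =>
    hdv.clm_apply contDiffOn_const
  have hφv : ∀ k, ContDiffOn ℝ 1 (fun p => φ k (v p)) B := fun k =>
    (hφc k).comp_contDiffOn (hv.of_le (by norm_num))
  -- one step
  have key : ∀ k, ∫⁻ w in B, ENNReal.ofReal (φ k (v w) * f w) ≤ ENNReal.ofReal (∫ w in B, g w) := by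
    intro k
    let K : Set (ℝ × ℝ) := closure B ∩ v ⁻¹' {t | 1 ≤ k * t}
    have hK : IsCompact K := hBc.of_isClosed_subset
      (hvc.preimage_isClosed_of_isClosed isClosed_closure
        (isClosed_le continuous_const (by fun_prop))) Set.inter_subset_left
    have hKB : K ⊆ B := by
      rintro p ⟨hp, hp1⟩
      by_contra hpB
      have := hv0 p hp hpB
      simp only [Set.mem_preimage, Set.mem_ofPred_eq, this] at hp1
      norm_num at hp1
    have hX := fun e => aux_div_zero hBo hK hKB (X := fun p => φ k (v p) * fderiv ℝ v p e)
      ((hφv k).mul (hdve e)) (by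
        intro p hp hpK
        have : φ k (v p) = 0 := by
          apply Real.smoothTransition.zero_of_nonpos
          by_contra hcon
          exact hpK ⟨subset_closure hp, by simp only [Set.mem_preimage, Set.mem_ofPred_eq]; linarith⟩
        simp [this]) e
    have hd : ∀ e, ∀ w ∈ B, φ k (v w) * fderiv ℝ (fun p => fderiv ℝ v p e) w e
        ≤ fderiv ℝ (fun p => φ k (v p) * fderiv ℝ v p e) w e := by
      intro e w hw
      have hn := hBo.mem_nhds hw
      have h1 : HasFDerivAt v (fderiv ℝ v w) w :=
        ((hv.contDiffAt hn).differentiableAt (by norm_num)).hasFDerivAt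
      have h2 : HasFDerivAt (fun p => fderiv ℝ v p e) (fderiv ℝ (fun p => fderiv ℝ v p e) w) w :=
        (((hdve e).contDiffAt hn).differentiableAt (by norm_num)).hasFDerivAt
      have h3 : HasDerivAt (φ k) (deriv (φ k) (v w)) (v w) :=
        ((hφc k).differentiable (by norm_num) _).hasDerivAt
      have h4 := (h3.comp_hasFDerivAt w h1).mul h2
      have h5 : fderiv ℝ (fun p => φ k (v p) * fderiv ℝ v p e) w = _ := h4.fderiv
      rw [h5]
      have h6 : 0 ≤ deriv (φ k) (v w) := (hφm k).deriv_nonneg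
      simp only [ContinuousLinearMap.add_apply, ContinuousLinearMap.smul_apply, smul_eq_mul,
        Function.comp]
      nlinarith [mul_nonneg h6 (mul_self_nonneg (fderiv ℝ v w e))]
    have hle : ∀ w ∈ B, φ k (v w) * f w ≤
        (fderiv ℝ (fun p => φ k (v p) * fderiv ℝ v p (1, 0)) w (1, 0)
        + fderiv ℝ (fun p => φ k (v p) * fderiv ℝ v p (0, 1)) w (0, 1)) + g w := by
      intro w hw
      have h1 : 0 ≤ φ k (v w) := Real.smoothTransition.nonneg _
      have h2 : φ k (v w) ≤ 1 := Real.smoothTransition.le_one _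
      have h3 := mul_le_mul_of_nonneg_left (hfg w hw) h1
      have h4 := mul_le_mul_of_nonneg_right h2 (hg0 w hw)
      have h5 := hd (1, 0) w hw
      have h6 := hd (0, 1) w hw
      linarith
    have hi2 : IntegrableOn (fun w => fderiv ℝ (fun p => φ k (v p) * fderiv ℝ v p (1, 0)) w (1, 0)
        + fderiv ℝ (fun p => φ k (v p) * fderiv ℝ v p (0, 1)) w (0, 1)) B :=
      (hX (1, 0)).1.add (hX (0, 1)).1
    have hi : IntegrableOn (fun w => (fderiv ℝ (fun p => φ k (v p) * fderiv ℝ v p (1, 0)) w (1, 0)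
        + fderiv ℝ (fun p => φ k (v p) * fderiv ℝ v p (0, 1)) w (0, 1)) + g w) B := hi2.add hg
    have hI : ∫ w in B, ((fderiv ℝ (fun p => φ k (v p) * fderiv ℝ v p (1, 0)) w (1, 0)
        + fderiv ℝ (fun p => φ k (v p) * fderiv ℝ v p (0, 1)) w (0, 1)) + g w)
        = ∫ w in B, g w := by
      rw [integral_add hi2 hg,
        integral_add (hX (1, 0)).1 (hX (0, 1)).1, (hX (1, 0)).2, (hX (0, 1)).2]
      simp
    rw [← hI, ofReal_integral_eq_lintegral_ofReal hi]
    · apply setLIntegral_mono' hBm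
      intro w hw
      exact ENNReal.ofReal_le_ofReal (hle w hw)
    · refine (ae_restrict_iff' hBm).2 (Filter.Eventually.of_forall fun w hw => ?_)
      exact (mul_nonneg (Real.smoothTransition.nonneg _) (hf0 w hw)).trans (hle w hw)
  have hlim : ∫⁻ w in B, ENNReal.ofReal (f w) ≤ ENNReal.ofReal (∫ w in B, g w) := by
    calc ∫⁻ w in B, ENNReal.ofReal (f w)
        ≤ ∫⁻ w in B, Filter.liminf (fun k => ENNReal.ofReal (φ k (v w) * f w)) Filter.atTop := by
          apply setLIntegral_mono' hBm
          intro w hw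
          apply le_of_eq
          symm
          apply Filter.Tendsto.liminf_eq
          apply tendsto_nhds_of_eventually_eq
          obtain ⟨m, hm⟩ := exists_nat_ge (2 / v w)
          filter_upwards [Filter.eventually_ge_atTop m] with k hk
          have : φ k (v w) = 1 := by
            apply Real.smoothTransition.one_of_one_le
            have h1 : 2 / v w ≤ k := hm.trans (by exact_mod_cast hk)
            rw [div_le_iff₀ (hvpos w hw)] at h1
            linarith
          rw [this, one_mul]
      _ ≤ Filter.liminf (fun k => ∫⁻ w in B, ENNReal.ofReal (φ k (v w) * f w)) Filter.atTop := by
          apply lintegral_liminf_le'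
          intro k
          exact (((hφv k).continuousOn.mul hf).aemeasurable hBm).ennreal_ofReal
      _ ≤ _ := Filter.liminf_le_of_frequently_le' (Filter.Frequently.of_forall key)
  rw [integral_eq_lintegral_of_nonneg_ae
    ((ae_restrict_iff' hBm).2 (Filter.Eventually.of_forall hf0)) (hf.aestronglyMeasurable hBm)]
  refine (ENNReal.toReal_mono ENNReal.ofReal_ne_top hlim).trans (le_of_eq ?_)
  exact ENNReal.toReal_ofReal (setIntegral_nonneg hBm hg0)

lemma aux_second {N : ℕ} {B : Set (ℝ × ℝ)} (hBo : IsOpen B)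
    {T : ℝ × ℝ → EuclideanSpace ℝ (Fin N)} (hT : ContDiffOn ℝ 2 T B)
    (ε : ℝ) (e : ℝ × ℝ) {w : ℝ × ℝ} (hw : w ∈ B) :
    fderiv ℝ (fun p => fderiv ℝ (fun q => ‖T q‖ ^ 2 + ε * (1 - q.1 ^ 2 - q.2 ^ 2)) p e) w e
      = 2 * ‖fderiv ℝ T w e‖ ^ 2 + 2 * inner ℝ (T w) (fderiv ℝ (fun p => fderiv ℝ T p e) w e)
        - 2 * ε * (e.1 ^ 2 + e.2 ^ 2) := by
  have hT' : ∀ p ∈ B, HasFDerivAt T (fderiv ℝ T p) p := fun p hp =>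
    ((hT.contDiffAt (hBo.mem_nhds hp)).differentiableAt (by norm_num)).hasFDerivAt
  have hq : ∀ p : ℝ × ℝ, HasFDerivAt (fun q : ℝ × ℝ => ε * (1 - q.1 ^ 2 - q.2 ^ 2))
      ((-2 * ε * p.1) • ContinuousLinearMap.fst ℝ ℝ ℝ
        + (-2 * ε * p.2) • ContinuousLinearMap.snd ℝ ℝ ℝ) p := by
    intro p
    have h1 : HasFDerivAt (fun q : ℝ × ℝ => q.1) (ContinuousLinearMap.fst ℝ ℝ ℝ) p := hasFDerivAt_fst
    have h2 : HasFDerivAt (fun q : ℝ × ℝ => q.2) (ContinuousLinearMap.snd ℝ ℝ ℝ) p := hasFDerivAt_snd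
    have := (((h1.pow 2).const_sub 1).sub (h2.pow 2)).const_mul ε
    refine this.congr_fderiv ?_
    ext <;> simp <;> ring
  have h1 : (fun p => fderiv ℝ (fun q => ‖T q‖ ^ 2 + ε * (1 - q.1 ^ 2 - q.2 ^ 2)) p e)
      =ᶠ[nhds w] fun p => 2 * inner ℝ (T p) (fderiv ℝ T p e)
        + (-2 * ε * (p.1 * e.1 + p.2 * e.2)) := by
    filter_upwards [hBo.mem_nhds hw] with p hp
    rw [((hT' p hp).norm_sq.fun_add (hq p)).fderiv]
    simp
    ring
  rw [h1.fderiv_eq]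
  have hdv : ContDiffOn ℝ 1 (fun p => fderiv ℝ T p e) B :=
    (hT.fderiv_of_isOpen hBo (m := 1) (by norm_num)).clm_apply contDiffOn_const
  have h2 : HasFDerivAt (fun p => fderiv ℝ T p e) (fderiv ℝ (fun p => fderiv ℝ T p e) w) w :=
    ((hdv.contDiffAt (hBo.mem_nhds hw)).differentiableAt (by norm_num)).hasFDerivAt
  have h3 : HasFDerivAt (fun p : ℝ × ℝ => (-2 * ε * (p.1 * e.1 + p.2 * e.2)))
      ((-2 * ε) • (e.1 • ContinuousLinearMap.fst ℝ ℝ ℝ + e.2 • ContinuousLinearMap.snd ℝ ℝ ℝ)) w := by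
    exact (((hasFDerivAt_fst (p := w)).mul_const e.1).add
      ((hasFDerivAt_snd (p := w)).mul_const e.2)).const_mul (-2 * ε)
  have h4 := (((hT' w hw).inner ℝ h2).const_mul 2).fun_add h3
  rw [h4.fderiv]
  simp [real_inner_self_eq_norm_sq]
  ring

/-- Upper bound for the total torsion of small solutions: if `𝒯` solves
`Δ𝒯 = -δ𝒯 + 𝒮` in `B`, `𝒯 = 0` on `∂B`, with
`|δ𝒯| ≤ (√(n-2)/2)|∇𝒯|²`, and `M` bounds `‖𝒯‖` on `B` with
`2 - √(n-2)·M > 0`, then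
`2‖∇𝒯‖²_{L²(B)} ≤ 4M‖𝒮‖_{L¹(B)} / (2 - √(n-2)M)`. -/
theorem total_torsion_upper_bound_small_solutions
    {n N : ℕ} (hn : 3 ≤ n) (hN : N = n * (n - 1) / 2)
    (B : Set (ℝ × ℝ)) (hB : B = {p : ℝ × ℝ | p.1 ^ 2 + p.2 ^ 2 < 1})
    (𝒯 δ𝒯 𝒮 : ℝ × ℝ → EuclideanSpace ℝ (Fin N))
    (hT : ContDiffOn ℝ 2 𝒯 B) (hTc : ContinuousOn 𝒯 (closure B))
    (hSc : ContinuousOn 𝒮 (closure B))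
    (hpde : ∀ w ∈ B,
      fderiv ℝ (fun p => fderiv ℝ 𝒯 p (1, 0)) w (1, 0)
        + fderiv ℝ (fun p => fderiv ℝ 𝒯 p (0, 1)) w (0, 1)
      = -δ𝒯 w + 𝒮 w)
    (hbd : ∀ w : ℝ × ℝ, w.1 ^ 2 + w.2 ^ 2 = 1 → 𝒯 w = 0)
    (hδ : ∀ w ∈ B, ‖δ𝒯 w‖ ≤ (Real.sqrt ((n : ℝ) - 2) / 2) *
      (‖fderiv ℝ 𝒯 w (1, 0)‖ ^ 2 + ‖fderiv ℝ 𝒯 w (0, 1)‖ ^ 2)) :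
    ∀ M : ℝ, (∀ w ∈ B, ‖𝒯 w‖ ≤ M) →
      2 - Real.sqrt ((n : ℝ) - 2) * M > 0 →
      2 * (∫ w in B, (‖fderiv ℝ 𝒯 w (1, 0)‖ ^ 2 + ‖fderiv ℝ 𝒯 w (0, 1)‖ ^ 2))
        ≤ 4 * M * (∫ w in B, ‖𝒮 w‖)
            / (2 - Real.sqrt ((n : ℝ) - 2) * M) := by
  intro M hM hc
  set s := Real.sqrt ((n : ℝ) - 2) with hs
  have hs0 : 0 ≤ s := Real.sqrt_nonneg _
  have hBo : IsOpen B := by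
    rw [hB]; exact isOpen_lt (by fun_prop) continuous_const
  have hcl : closure B ⊆ {p : ℝ × ℝ | p.1 ^ 2 + p.2 ^ 2 ≤ 1} := by
    apply closure_minimal
    · rw [hB]; intro p hp; exact le_of_lt (show p.1 ^ 2 + p.2 ^ 2 < 1 from hp)
    · exact isClosed_le (by fun_prop) continuous_const
  have hBc : IsCompact (closure B) := by
    refine (isCompact_Icc (a := ((-1, -1) : ℝ × ℝ)) (b := (1, 1))).of_isClosed_subset
      isClosed_closure ?_
    intro p hp
    have := hcl hp
    simp only [Set.mem_ofPred_eq] at this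
    refine ⟨⟨?_, ?_⟩, ⟨?_, ?_⟩⟩ <;> simp only <;> nlinarith [sq_nonneg p.1, sq_nonneg p.2]
  have hM0 : 0 ≤ M := (norm_nonneg _).trans (hM (0, 0) (by rw [hB]; simp))
  have hSi : IntegrableOn (fun w => ‖𝒮 w‖) B :=
    (hSc.norm.integrableOn_compact hBc).mono_set subset_closure
  have hBfin : volume B ≠ ⊤ := ((measure_mono subset_closure).trans_lt hBc.measure_lt_top).ne
  have hci : ∀ a : ℝ, IntegrableOn (fun _ : ℝ × ℝ => a) B := fun a => integrableOn_const hBfin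
  have hde : ∀ e, ContinuousOn (fun w => fderiv ℝ 𝒯 w e) B := fun e =>
    ((hT.fderiv_of_isOpen hBo (m := 1) (by norm_num)).clm_apply contDiffOn_const).continuousOn
  set G : ℝ × ℝ → ℝ := fun w => ‖fderiv ℝ 𝒯 w (1, 0)‖ ^ 2 + ‖fderiv ℝ 𝒯 w (0, 1)‖ ^ 2 with hG
  have hGc : ContinuousOn G B := ((hde _).norm.pow 2).add ((hde _).norm.pow 2)
  have hG0 : ∀ w, 0 ≤ G w := fun w => by positivity
  have main : ∀ ε : ℝ, 0 < ε → (2 - s * M) * ∫ w in B, G w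
      ≤ 2 * M * (∫ w in B, ‖𝒮 w‖) + ε * (4 * volume.real B) := by
    intro ε hε
    have h := aux_bound hBo hBc (v := fun q => ‖𝒯 q‖ ^ 2 + ε * (1 - q.1 ^ 2 - q.2 ^ 2))
      (f := fun w => (2 - s * M) * G w) (g := fun w => 2 * M * ‖𝒮 w‖ + 4 * ε)
      ((hT.norm_sq ℝ).add (by fun_prop))
      ((hTc.norm.pow 2).add (by fun_prop))
      (by
        intro p hp hpB
        have h1 := hcl hp
        simp only [Set.mem_ofPred_eq] at h1
        have h2 : ¬ (p.1 ^ 2 + p.2 ^ 2 < 1) := by rw [hB] at hpB; exact hpB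
        have h3 : p.1 ^ 2 + p.2 ^ 2 = 1 := le_antisymm h1 (not_lt.1 h2)
        have h4 : 1 - p.1 ^ 2 - p.2 ^ 2 = 0 := by linarith
        simp [hbd p h3, h4])
      (by
        intro p hp
        rw [hB] at hp
        simp only [Set.mem_ofPred_eq] at hp
        have : 0 < ε * (1 - p.1 ^ 2 - p.2 ^ 2) := mul_pos hε (by linarith)
        positivity)
      (continuousOn_const.mul hGc) (fun p _ => mul_nonneg hc.le (hG0 p))
      ((hSi.const_mul _).add (hci _))
      (fun p _ => by positivity)
      (by
        intro w hw
        rw [aux_second hBo hT ε (1, 0) hw, aux_second hBo hT ε (0, 1) hw]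
        have hp := hpde w hw
        have h1 : inner ℝ (𝒯 w) (fderiv ℝ (fun p => fderiv ℝ 𝒯 p (1, 0)) w (1, 0))
          + inner ℝ (𝒯 w) (fderiv ℝ (fun p => fderiv ℝ 𝒯 p (0, 1)) w (0, 1))
          = inner ℝ (𝒯 w) (-δ𝒯 w + 𝒮 w) := by rw [← inner_add_right, hp]
        have h2 : |inner ℝ (𝒯 w) (-δ𝒯 w + 𝒮 w)| ≤ M * (s / 2 * G w + ‖𝒮 w‖) := by
          refine (abs_real_inner_le_norm _ _).trans ?_
          refine mul_le_mul (hM w hw) ?_ (norm_nonneg _) hM0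
          refine (norm_add_le _ _).trans ?_
          rw [norm_neg]
          exact add_le_add_left (hδ w hw) _
        have h3 := (abs_le.1 h2).1
        simp only [hG] at h3 ⊢
        nlinarith)
    rw [integral_const_mul, integral_add (hSi.const_mul _) (hci _), integral_const_mul] at h
    simp only [integral_const, measureReal_restrict_apply_univ, smul_eq_mul] at h
    linarith
  have hfin : (2 - s * M) * ∫ w in B, G w ≤ 2 * M * (∫ w in B, ‖𝒮 w‖) := by
    have hv : 0 ≤ 4 * volume.real B := by positivity
    refine le_of_forall_pos_le_add fun η hη => ?_
    refine (main (η / (4 * volume.real B + 1)) (by positivity)).trans ?_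
    have : η / (4 * volume.real B + 1) * (4 * volume.real B) ≤ η := by
      rw [div_mul_eq_mul_div, div_le_iff₀ (by positivity)]
      nlinarith
    linarith
  rw [le_div_iff₀ hc]
  linarith
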